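/- In the base case M = 1: if ±m(x^{b⁺} - x^{b⁻}) = x^{c⁺} - x^{c⁻} for a monomial m = x^d, a vector b ∈ ℤ^r with positive/negative parts b⁺, b⁻, and c⁺, c⁻ ∈ ℕ^r, then c⁺ - c⁻ = ±b. -/

import Mathlib

open MvPolynomial

noncomputable def xpow {r : ℕ} (d : Fin r → ℕ) : MvPolynomial (Fin r) ℤ :=
  ∏ j, X j ^ d j

def posPart {r : ℕ} (b : Fin r → ℤ) : Fin r → ℕ := fun j => (b j).toNat
def negPart {r : ℕ} (b : Fin r → ℤ) : Fin r → ℕ := fun j => (-(b j)).toNat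

lemma eval_one_xpow {r : ℕ} (d : Fin r → ℕ) : eval (fun _ => (1 : ℤ)) (xpow d) = 1 := by
  simp [xpow]

lemma xpow_eq_monomial {r : ℕ} (d : Fin r → ℕ) :
    xpow d = monomial (Finsupp.equivFunOnFinite.symm d) (1 : ℤ) := by
  rw [monomial_eq, Finsupp.prod_fintype _ _ (by simp)]
  simp [xpow]

lemma eval_pderiv_xpow {r : ℕ} (k : Fin r) (d : Fin r → ℕ) :
    eval (fun _ => (1 : ℤ)) (pderiv k (xpow d)) = d k := by
  rw [xpow_eq_monomial, pderiv_monomial, eval_monomial]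
  simp [Finsupp.prod]

/-- Base case `M = 1`: if `±m(x^{b⁺} - x^{b⁻}) = x^{c⁺} - x^{c⁻}` for a monomial
`m = x^d`, then `c⁺ - c⁻ = ±b` (with the same sign). -/
theorem stmt6 (r : ℕ) (s : ℤ) (hs : s = 1 ∨ s = -1) (d : Fin r → ℕ)
    (b : Fin r → ℤ) (cp cm : Fin r → ℕ)
    (h : C s * (xpow d * (xpow (posPart b) - xpow (negPart b))) = xpow cp - xpow cm) :
    ∀ k, (cp k : ℤ) - (cm k : ℤ) = s * b k := by
  intro k
  have h2 := congrArg (fun p => eval (fun _ => (1 : ℤ)) (pderiv k p)) h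
  simp only [Derivation.leibniz, map_sub, map_add, smul_eq_mul, map_mul, eval_one_xpow,
    eval_pderiv_xpow, eval_C, pderiv_C, map_zero] at h2
  have h3 : ((_root_.posPart b k : ℕ) : ℤ) - (_root_.negPart b k : ℕ) = b k := by
    change (((b k).toNat : ℕ) : ℤ) - ((-(b k)).toNat : ℕ) = b k
    omega
  rw [← h2, ← h3]
  ring
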